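/- arXiv:1204.1936 — 2 statements merged into one kernel-verified Lean document; each statement's English description precedes it below -/
import Mathlib

section
/- Every generalized k-forest 𝒯 on v vertices is a subfamily of a tight k-tree 𝒯⁺ on the same vertex set. -/
/-- A generalized `k`-forest, presented as a list of edges together with the list of
defining sets: a single `k`-edge is a `k`-forest; one may add a new edge `A ∪ B` where
`A` is contained in some existing edge and `B` is disjoint from the current vertex set,
with `|A| + |B| = k`. -/
inductive KForest {α : Type*} [DecidableEq α] (k : ℕ) :
    List (Finset α) → List (Finset α) → Prop
  | single (E : Finset α) (hE : E.card = k) : KForest k [E] []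
  | extend {l As : List (Finset α)} (h : KForest k l As) (A B E : Finset α)
      (hE : E ∈ l) (hA : A ⊆ E) (hB : ∀ F ∈ l, Disjoint B F)
      (hcard : A.card + B.card = k) : KForest k (l ++ [A ∪ B]) (As ++ [A])

/-- The vertex set of a family of edges. -/
def vset {α : Type*} [DecidableEq α] (l : List (Finset α)) : Finset α :=
  l.foldr (· ∪ ·) ∅

/-- A family of edges is connected (as a hypergraph) if any two of its edges are linked by
a chain of pairwise intersecting edges of the family. -/
def HyperConnected {α : Type*} [DecidableEq α] (l : List (Finset α)) : Prop :=
  ∀ E ∈ l, ∀ F ∈ l,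
    Relation.ReflTransGen (fun X Y => X ∈ l ∧ Y ∈ l ∧ (X ∩ Y).Nonempty) E F

theorem mem_vset {α : Type*} [DecidableEq α] {l : List (Finset α)} {x : α} :
    x ∈ vset l ↔ ∃ F ∈ l, x ∈ F := by
  induction l with
  | nil => simp [vset]
  | cons F l ih =>
    have hcons : vset (F :: l) = F ∪ vset l := rfl
    simp [hcons, ih]

theorem vset_append_singleton {α : Type*} [DecidableEq α] (l : List (Finset α)) (E : Finset α) :
    vset (l ++ [E]) = vset l ∪ E := by
  ext x
  simp only [mem_vset, Finset.mem_union, List.mem_append, List.mem_singleton]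
  grind

theorem subset_vset {α : Type*} [DecidableEq α] {l : List (Finset α)} {E : Finset α}
    (hE : E ∈ l) : E ⊆ vset l :=
  fun _ hx => mem_vset.2 ⟨E, hE, hx⟩

theorem disjoint_vset {α : Type*} [DecidableEq α] {l : List (Finset α)} {B : Finset α} :
    Disjoint B (vset l) ↔ ∀ F ∈ l, Disjoint B F := by
  simp only [Finset.disjoint_left, mem_vset]
  grind

theorem KForest.card_edge {α : Type*} [DecidableEq α] {k : ℕ} {l As : List (Finset α)}
    (h : KForest k l As) : ∀ E ∈ l, E.card = k := by
  induction h with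
  | single E hE => simpa using hE
  | extend _ A B E hE hA hB hcard ih =>
    intro F hF
    rcases List.mem_append.1 hF with hF | hF
    · exact ih F hF
    · rw [List.mem_singleton.1 hF, Finset.card_union_of_disjoint, hcard]
      exact (Finset.disjoint_of_subset_right hA (hB E hE)).symm

/-- Adding an edge that meets an existing edge preserves connectedness. -/
theorem HyperConnected.append_singleton {α : Type*} [DecidableEq α] {l : List (Finset α)}
    (h : HyperConnected l) {E N : Finset α} (hE : E ∈ l) (hEN : (E ∩ N).Nonempty) :
    HyperConnected (l ++ [N]) := by
  have old : ∀ X ∈ l, ∀ Y ∈ l, Relation.ReflTransGen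
      (fun X Y => X ∈ l ++ [N] ∧ Y ∈ l ++ [N] ∧ (X ∩ Y).Nonempty) X Y := fun X hX Y hY =>
    Relation.ReflTransGen.mono (fun _ _ ⟨h₁, h₂, h₃⟩ =>
      ⟨List.mem_append_left _ h₁, List.mem_append_left _ h₂, h₃⟩) X Y (h X hX Y hY)
  have hE' : E ∈ l ++ [N] := List.mem_append_left _ hE
  have hN : N ∈ l ++ [N] := by simp
  intro X hX Y hY
  rcases List.mem_append.1 hX with hXl | hXN <;> rcases List.mem_append.1 hY with hYl | hYN
  · exact old X hXl Y hYl
  · rw [List.mem_singleton.1 hYN]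
    exact (old X hXl E hE).tail ⟨hE', hN, hEN⟩
  · rw [List.mem_singleton.1 hXN]
    exact (old E hE Y hYl).head ⟨hN, hE', by rwa [Finset.inter_comm]⟩
  · rw [List.mem_singleton.1 hXN, List.mem_singleton.1 hYN]

theorem KForest.hyperConnected {α : Type*} [DecidableEq α] {k : ℕ} {l As : List (Finset α)}
    (h : KForest k l As) (hAs : ∀ A ∈ As, A.Nonempty) : HyperConnected l := by
  induction h with
  | single E hE =>
    intro X hX Y hY
    rw [List.mem_singleton.1 hX, List.mem_singleton.1 hY]
  | extend _ A B E hE hA hB hcard ih =>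
    refine (ih fun A' hA' => hAs A' (List.mem_append_left _ hA')).append_singleton hE ?_
    exact (hAs A (by simp)).mono (Finset.subset_inter hA Finset.subset_union_left)

/-- A forest whose defining sets have `k - 1` elements can be enlarged, one vertex of `B` at a
time, to a forest of the same kind containing a prescribed new edge `A ∪ B`. -/
theorem KForest.exists_tight_extension {α : Type*} [DecidableEq α] {k : ℕ}
    {l As : List (Finset α)} (h : KForest k l As) (hAs : ∀ A ∈ As, A.card = k - 1)
    {E : Finset α} (hE : E ∈ l) (B : Finset α) (hB : Disjoint B (vset l)) :
    ∀ A ⊆ E, A.card + B.card = k → ∃ l' As' : List (Finset α), KForest k l' As' ∧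
      (∀ A ∈ As', A.card = k - 1) ∧ (∀ F ∈ l, F ∈ l') ∧ A ∪ B ∈ l' ∧
      vset l' = vset l ∪ B := by
  have hEk := h.card_edge E hE
  induction B using Finset.induction_on with
  | empty =>
    intro A hA hcard
    obtain rfl : A = E := Finset.eq_of_subset_of_card_le hA (by simp at hcard; omega)
    exact ⟨l, As, h, hAs, fun _ => id, by simpa using hE, by simp⟩
  | insert b B hb ih =>
    intro A hA hcard
    rw [Finset.disjoint_insert_left] at hB
    rw [Finset.card_insert_of_notMem hb] at hcard
    obtain ⟨a, haE, haA⟩ := Finset.exists_mem_notMem_of_card_lt_card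
      (show A.card < E.card by omega)
    obtain ⟨l', As', h', hAs', hl, hmem, hv⟩ := ih hB.2 (insert a A)
      (Finset.insert_subset haE hA) (by rw [Finset.card_insert_of_notMem haA]; omega)
    have hAB : (A ∪ B).card = A.card + B.card := Finset.card_union_of_disjoint
      (Finset.disjoint_of_subset_right (hA.trans (subset_vset hE)) hB.2).symm
    have hb' : Disjoint {b} (vset l') := by
      simp [hv, hb, hB.1]
    refine ⟨l' ++ [(A ∪ B) ∪ {b}], As' ++ [A ∪ B],
      h'.extend (A ∪ B) {b} _ hmem (by grind) (disjoint_vset.1 hb') (by simp; omega),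
      ?_, fun F hF => List.mem_append_left _ (hl F hF), ?_, ?_⟩
    · intro C hC
      rcases List.mem_append.1 hC with hC | hC
      · exact hAs' C hC
      · rw [List.mem_singleton.1 hC]
        omega
    · rw [List.mem_append, List.mem_singleton]
      right
      grind
    · have hAv : A ⊆ vset l := hA.trans (subset_vset hE)
      rw [vset_append_singleton, hv]
      grind

/-- Every generalized `k`-forest is a subfamily of a tight `k`-tree on the same vertex set. -/
theorem stmt_6 {α : Type*} [DecidableEq α] (k : ℕ) (hk : 2 ≤ k)
    (l As : List (Finset α)) (h : KForest k l As) :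
    ∃ (l' As' : List (Finset α)), KForest k l' As' ∧ HyperConnected l' ∧
      (∀ A ∈ As', A.card = k - 1) ∧ (∀ E ∈ l, E ∈ l') ∧ vset l' = vset l := by
  suffices H : ∃ (l' As' : List (Finset α)), KForest k l' As' ∧
      (∀ A ∈ As', A.card = k - 1) ∧ (∀ E ∈ l, E ∈ l') ∧ vset l' = vset l by
    obtain ⟨l', As', h', hAs', hl, hv⟩ := H
    refine ⟨l', As', h', h'.hyperConnected fun A hA => ?_, hAs', hl, hv⟩
    rw [← Finset.card_pos, hAs' A hA]
    omega
  induction h with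
  | single E hE => exact ⟨[E], [], .single E hE, by simp, fun _ => id, rfl⟩
  | extend _ A B E hE hA hB hcard ih =>
    obtain ⟨l', As', h', hAs', hl, hv⟩ := ih
    obtain ⟨m, Bs, hm, hBs, hlm, hmem, hvm⟩ := h'.exists_tight_extension hAs' (hl E hE) B
      (hv ▸ disjoint_vset.2 hB) A hA hcard
    refine ⟨m, Bs, hm, hBs, fun F hF => ?_, ?_⟩
    · rcases List.mem_append.1 hF with hF | hF
      · exact hlm F (hl F hF)
      · rwa [List.mem_singleton.1 hF]
    · have hAv := hA.trans (subset_vset hE)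
      rw [hvm, hv, vset_append_singleton]
      grind
end

section
/- Let T be a forest on v vertices with at least one edge that is not a star, and k ≥ 4. Then ex_k(n, T^{(k)}) ≤ (σ(T) − 1 + o(1))·C(n, k−1) as n → ∞; combined with the lower bound, ex_k(n, T^{(k)}) = (σ(T) − 1 + o(1))·C(n, k−1). -/
/-- The `k`-expansion `T^(k)` of a graph `T`: each edge `e = xy` of `T` is replaced by the
`k`-set consisting of `x`, `y` and `k - 2` new vertices private to `e` (so new vertices of
distinct edges are distinct, and disjoint from `V(T)`). -/
def expansion (k : ℕ) {V : Type*} [Fintype V] [DecidableEq V] (T : SimpleGraph V)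
    [DecidableRel T.Adj] : Finset (Finset (V ⊕ Sym2 V × Fin (k - 2))) :=
  T.edgeFinset.image (fun e =>
    ((Finset.univ.filter (fun v => v ∈ e)).image Sum.inl) ∪
      (Finset.univ.image (fun i : Fin (k - 2) => Sum.inr (e, i))))

/-- `σ(T) = min { |X| + e(T ∖ X) : X independent in T }`. -/
noncomputable def graphSigma {V : Type*} (T : SimpleGraph V) : ℕ :=
  sInf {m | ∃ X : Set V, (∀ x ∈ X, ∀ y ∈ X, ¬ T.Adj x y) ∧ X.Finite ∧
    m = X.ncard + {e ∈ T.edgeSet | ∀ x ∈ X, x ∉ e}.ncard}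

/-- `τ(T)`: the minimum size of a set of vertices meeting every edge of `T`. -/
noncomputable def graphTau {V : Type*} (T : SimpleGraph V) : ℕ :=
  sInf {m | ∃ S : Set V, (∀ e ∈ T.edgeSet, ∃ x ∈ S, x ∈ e) ∧ S.Finite ∧ m = S.ncard}

/-- `H` contains a copy of the hypergraph `Ts` (a subhypergraph isomorphic to `Ts`). -/
def ContainsCopy {α β : Type*} [DecidableEq α] [DecidableEq β]
    (H : Finset (Finset β)) (Ts : Finset (Finset α)) : Prop :=
  ∃ f : α → β, Set.InjOn f ↑(Ts.sup id) ∧ ∀ E ∈ Ts, E.image f ∈ H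

section

open Finset

/-- An acyclic graph with an edge has a vertex with exactly one neighbour. -/
theorem SimpleGraph.IsAcyclic.exists_leaf {V : Type*} [Finite V] {T : SimpleGraph V}
    (hT : T.IsAcyclic) (hne : T.edgeSet.Nonempty) :
    ∃ x y, T.Adj x y ∧ ∀ z, T.Adj y z → z = x := by
  classical
  obtain ⟨⟨a, b⟩, hab⟩ := hne
  have hab : T.Adj a b := hab
  have : Nonempty V := ⟨a⟩
  obtain ⟨u, v, p, hp, hmax⟩ := SimpleGraph.Walk.exists_isPath_forall_isPath_length_le_length T
  have hlen : 1 ≤ p.length :=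
    hmax a b (.cons hab .nil) (by simp [hab.ne])
  have hnil : ¬ p.Nil := by
    rw [← SimpleGraph.Walk.length_eq_zero_iff]; omega
  refine ⟨p.snd, u, (p.adj_snd hnil).symm, fun z hz => ?_⟩
  by_cases hzs : z ∈ p.support
  · exact hT.eq_snd_of_adj_start hp hz hzs
  · have := hmax z v (.cons hz.symm p) (hp.cons hzs)
    simp at this

/-- `g` and `F` realise the graph `T` by hyperedges of `𝓗`: the hyperedge `F e` contains the images
under `g` of the endpoints of `e`, and distinct hyperedges meet only in images of common endpoints.
The vertices in `X` are ignored. -/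
structure LinearRealization {V β : Type*} (T : SimpleGraph V) (X : Set V)
    (𝓗 : Finset (Finset β)) (g : V → β) (F : Sym2 V → Finset β) : Prop where
  mem_family : ∀ e ∈ T.edgeSet, F e ∈ 𝓗
  mem_edge : ∀ e ∈ T.edgeSet, ∀ v ∈ e, v ∉ X → g v ∈ F e
  ne_of_adj : ∀ x y, T.Adj x y → x ∉ X → y ∉ X → g x ≠ g y
  inter : ∀ e ∈ T.edgeSet, ∀ e' ∈ T.edgeSet, e ≠ e' → ∀ u ∈ F e, u ∈ F e' →
    ∃ v, v ∉ X ∧ v ∈ e ∧ v ∈ e' ∧ u = g v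

/-- Every hyperedge of `𝓗` has two vertices in `A`, and every vertex of `A` lies in a hyperedge
avoiding any prescribed set of at most `t` other vertices. -/
structure Extendable {β : Type*} (t : ℕ) (A : Set β) (𝓗 : Finset (Finset β)) : Prop where
  nonempty : 𝓗.Nonempty
  two_mem : ∀ E ∈ 𝓗, ∃ v ∈ E, ∃ w ∈ E, v ≠ w ∧ v ∈ A ∧ w ∈ A
  extend : ∀ v ∈ A, ∀ U : Finset β, U.card ≤ t → v ∉ U → ∃ E ∈ 𝓗, v ∈ E ∧ Disjoint E U

namespace Extendable

variable {β : Type*} [DecidableEq β] {t : ℕ} {A : Set β} {𝓗 : Finset (Finset β)}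

theorem exists_disjoint (h : Extendable t A 𝓗) (U : Finset β) (hU : U.card ≤ t) :
    ∃ E ∈ 𝓗, Disjoint E U := by
  obtain ⟨E₀, hE₀⟩ := h.nonempty
  obtain ⟨v, -, -, -, -, hv, -⟩ := h.two_mem E₀ hE₀
  obtain ⟨E₁, hE₁, hvE₁, hd⟩ := h.extend v hv (U.erase v) ((card_erase_le).trans hU) (by simp)
  obtain ⟨w, hwA, hwv, hwE⟩ : ∃ w ∈ A, w ≠ v ∧ w ∈ E₁ := by
    obtain ⟨a, ha, b, hb, hab, haA, hbA⟩ := h.two_mem E₁ hE₁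
    by_cases hav : a = v
    · exact ⟨b, hbA, fun hbv => hab (hav.trans hbv.symm), hb⟩
    · exact ⟨a, haA, hav, ha⟩
  have hwU : w ∉ U := fun hw => disjoint_left.1 hd hwE (mem_erase.2 ⟨hwv, hw⟩)
  obtain ⟨E, hE, -, hEU⟩ := h.extend w hwA U hU hwU
  exact ⟨E, hE, hEU⟩

theorem exists_realization_aux {V : Type*} [Finite V] (X : Set V)
    (h : Extendable t A 𝓗) {k : ℕ} (hk : ∀ E ∈ 𝓗, E.card ≤ k) (m : ℕ) :
    ∀ T : SimpleGraph V, T.IsAcyclic → T.edgeSet.ncard = m → k * m ≤ t →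
      ∃ g F, LinearRealization T X 𝓗 g F ∧ ∀ e ∈ T.edgeSet, ∀ v ∈ e, v ∉ X → g v ∈ A := by
  classical
  have : Fintype V := Fintype.ofFinite V
  induction m with
  | zero =>
    intro T _ hm _
    have hE : T.edgeSet = ∅ := (Set.ncard_eq_zero (Set.toFinite _)).1 hm
    obtain ⟨E₀, hE₀⟩ := h.nonempty
    obtain ⟨v, -⟩ := h.two_mem E₀ hE₀
    refine ⟨fun _ => v, fun _ => E₀, ⟨?_, ?_, ?_, ?_⟩, ?_⟩
    all_goals try simp [hE]
    intro x y hxy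
    have : s(x, y) ∈ T.edgeSet := hxy
    simp [hE] at this
  | succ m ih =>
    intro T hT hm hkt
    have hTne : T.edgeSet.Nonempty := by
      rw [Set.nonempty_iff_ne_empty]; rintro h0; rw [h0] at hm; simp at hm
    obtain ⟨x, y, hxy, hleaf⟩ := hT.exists_leaf hTne
    set e₀ : Sym2 V := s(x, y) with he₀
    have he₀T : e₀ ∈ T.edgeSet := hxy
    set T' := T.deleteEdges {e₀} with hT'
    have hT'E : T'.edgeSet = T.edgeSet \ {e₀} := SimpleGraph.edgeSet_deleteEdges _
    have hm' : T'.edgeSet.ncard = m := by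
      rw [hT'E, Set.ncard_sdiff_singleton_of_mem he₀T, hm]; rfl
    obtain ⟨g, F, hR, hA⟩ := ih T' (hT.anti (SimpleGraph.deleteEdges_le _)) hm' (by nlinarith)
    have hxyne : x ≠ y := hxy.ne
    have hy : ∀ e ∈ T'.edgeSet, y ∉ e := by
      intro e he hye
      obtain ⟨z, rfl⟩ := Sym2.mem_iff_exists.1 hye
      rw [hT'E] at he
      have := hleaf z he.1
      subst this
      exact he.2 (by rw [he₀]; exact Sym2.eq_swap)
    have hsplit : ∀ e ∈ T.edgeSet, e = e₀ ∨ e ∈ T'.edgeSet := by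
      intro e he
      rw [hT'E]
      by_cases h1 : e = e₀
      · exact .inl h1
      · exact .inr ⟨he, h1⟩
    have hne₀ : ∀ e ∈ T'.edgeSet, e ≠ e₀ := by
      intro e he; rw [hT'E] at he; exact he.2
    set U := T'.edgeSet.toFinset.biUnion F with hU
    have hUmem : ∀ u, u ∈ U ↔ ∃ e ∈ T'.edgeSet, u ∈ F e := by
      intro u; simp [hU]
    have hUcard : U.card ≤ t := by
      calc U.card ≤ T'.edgeSet.toFinset.card * k :=
            card_biUnion_le_card_mul _ _ _ fun e he => hk _ (hR.mem_family e (by simpa using he))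
        _ = m * k := by rw [← Set.ncard_eq_toFinset_card', hm']
        _ ≤ t := by nlinarith
    /- It suffices to choose the hyperedge of the leaf edge and the images of its endpoints. -/
    suffices hmain : ∃ (E : Finset β) (a b : β), E ∈ 𝓗 ∧ a ∈ E ∧ b ∈ E ∧ a ≠ b ∧ a ∈ A ∧ b ∈ A ∧
        (∀ e ∈ T'.edgeSet, x ∈ e → x ∉ X → g x = a) ∧
        (∀ e ∈ T'.edgeSet, ∀ u ∈ E, u ∈ F e → u = a ∧ x ∉ X ∧ x ∈ e) by
      obtain ⟨E, a, b, hE, haE, hbE, hab, haA, hbA, hgx, hinter⟩ := hmain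
      set g' := Function.update (Function.update g x a) y b with hg'
      have hg'y : g' y = b := by simp [hg']
      have hg'x : g' x = a := by simp [hg', hxyne]
      have hg' : ∀ e ∈ T'.edgeSet, ∀ v ∈ e, v ∉ X → g' v = g v := by
        intro e he v hv hvX
        have hvy : v ≠ y := by rintro rfl; exact hy e he hv
        by_cases hvx : v = x
        · subst hvx; rw [hg'x, hgx e he hv hvX]
        · simp [hg', hvy, hvx]
      have hF' : ∀ e ∈ T'.edgeSet, Function.update F e₀ E e = F e := fun e he => by
        simp [hne₀ e he]
      refine ⟨g', Function.update F e₀ E, ⟨?_, ?_, ?_, ?_⟩, ?_⟩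
      · intro e he
        rcases hsplit e he with rfl | he'
        · simpa using hE
        · rw [hF' e he']; exact hR.mem_family e he'
      · intro e he v hv hvX
        rcases hsplit e he with rfl | he'
        · rw [Function.update_self]
          rcases Sym2.mem_iff.1 hv with rfl | rfl
          · rwa [hg'x]
          · rwa [hg'y]
        · rw [hF' e he', hg' e he' v hv hvX]; exact hR.mem_edge e he' v hv hvX
      · intro v w hvw hv hw
        rcases hsplit s(v, w) hvw with h0 | he'
        · rcases Sym2.eq_iff.1 h0 with ⟨rfl, rfl⟩ | ⟨rfl, rfl⟩
          · rwa [hg'x, hg'y]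
          · rw [hg'x, hg'y]; exact hab.symm
        · rw [hg' _ he' v (by simp) hv, hg' _ he' w (by simp) hw]
          exact hR.ne_of_adj v w he' hv hw
      · intro e he e' he' hee' u hu hu'
        rcases hsplit e he with rfl | h1 <;> rcases hsplit e' he' with rfl | h2
        · exact absurd rfl hee'
        · rw [Function.update_self] at hu
          rw [hF' e' h2] at hu'
          obtain ⟨rfl, hxX, hxe⟩ := hinter e' h2 u hu hu'
          exact ⟨x, hxX, by simp [he₀], hxe, hg'x.symm⟩
        · rw [Function.update_self] at hu'
          rw [hF' e h1] at hu
          obtain ⟨rfl, hxX, hxe⟩ := hinter e h1 u hu' hu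
          exact ⟨x, hxX, hxe, by simp [he₀], hg'x.symm⟩
        · rw [hF' e h1] at hu
          rw [hF' e' h2] at hu'
          obtain ⟨v, hvX, hve, hve', rfl⟩ := hR.inter e h1 e' h2 hee' u hu hu'
          exact ⟨v, hvX, hve, hve', (hg' e h1 v hve hvX).symm⟩
      · intro e he v hv hvX
        rcases hsplit e he with rfl | he'
        · rcases Sym2.mem_iff.1 hv with rfl | rfl
          · rwa [hg'x]
          · rwa [hg'y]
        · rw [hg' e he' v hv hvX]; exact hA e he' v hv hvX
    by_cases hx : x ∉ X ∧ ∃ e ∈ T'.edgeSet, x ∈ e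
    · obtain ⟨hxX, e₁, he₁, hxe₁⟩ := hx
      obtain ⟨E, hE, hgE, hd⟩ := h.extend (g x) (hA e₁ he₁ x hxe₁ hxX) (U.erase (g x))
        (card_erase_le.trans hUcard) (by simp)
      obtain ⟨b, hbA, hbx, hbE⟩ : ∃ b ∈ A, b ≠ g x ∧ b ∈ E := by
        obtain ⟨a, ha, b, hb, hab, haA, hbA⟩ := h.two_mem E hE
        by_cases hax : a = g x
        · exact ⟨b, hbA, fun hbx => hab (hax.trans hbx.symm), hb⟩
        · exact ⟨a, haA, hax, ha⟩
      refine ⟨E, g x, b, hE, hgE, hbE, hbx.symm, hA e₁ he₁ x hxe₁ hxX, hbA,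
        fun _ _ _ _ => rfl, fun e he u hu hue => ?_⟩
      have hux : u = g x := by
        by_contra hux
        exact disjoint_left.1 hd hu (mem_erase.2 ⟨hux, (hUmem u).2 ⟨e, he, hue⟩⟩)
      refine ⟨hux, hxX, ?_⟩
      by_cases hee : e₁ = e
      · exact hee ▸ hxe₁
      subst hux
      obtain ⟨v, hvX, hv₁, hve, hgv⟩ :=
        hR.inter e₁ he₁ e he hee (g x) (hR.mem_edge e₁ he₁ x hxe₁ hxX) hue
      by_cases hvx : x = v
      · exact hvx ▸ hve
      · have : e₁ = s(x, v) := ((Sym2.mem_and_mem_iff hvx).1 ⟨hxe₁, hv₁⟩)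
        subst this
        exact absurd hgv (hR.ne_of_adj x v he₁ hxX hvX)
    · obtain ⟨E, hE, hd⟩ := h.exists_disjoint U hUcard
      obtain ⟨a, ha, b, hb, hab, haA, hbA⟩ := h.two_mem E hE
      refine ⟨E, a, b, hE, ha, hb, hab, haA, hbA, fun e he hxe hxX => ?_, fun e he u hu hue => ?_⟩
      · exact absurd ⟨hxX, e, he, hxe⟩ hx
      · exact absurd ((hUmem u).2 ⟨e, he, hue⟩) (disjoint_left.1 hd hu)

/-- A forest embeds greedily in an extendable family. -/
theorem exists_realization {V : Type*} [Finite V] (X : Set V) (h : Extendable t A 𝓗) {k : ℕ}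
    (hk : ∀ E ∈ 𝓗, E.card ≤ k) {T : SimpleGraph V} (hT : T.IsAcyclic)
    (ht : k * T.edgeSet.ncard ≤ t) : ∃ g F, LinearRealization T X 𝓗 g F :=
  let ⟨g, F, hR, _⟩ := exists_realization_aux X h hk _ T hT rfl ht
  ⟨g, F, hR⟩

end Extendable

theorem LinearRealization.eq_of_map_eq {V β : Type*} {T : SimpleGraph V} {X : Set V}
    {𝓗 : Finset (Finset β)} {g : V → β} {F : Sym2 V → Finset β}
    (hR : LinearRealization T X 𝓗 g F) {e e' : Sym2 V} (he : e ∈ T.edgeSet) (he' : e' ∈ T.edgeSet)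
    {v w : V} (hv : v ∈ e) (hw : w ∈ e') (hvX : v ∉ X) (hwX : w ∉ X) (hvw : g v = g w) :
    v = w := by
  classical
  have key : ∀ {a b : V}, a ∉ X → b ∉ X → ∀ f ∈ T.edgeSet, a ∈ f → b ∈ f → g a = g b → a = b := by
    intro a b ha hb f hf haf hbf hab
    by_contra hne
    have : f = s(a, b) := ((Sym2.mem_and_mem_iff hne).1 ⟨haf, hbf⟩)
    subst this
    exact hR.ne_of_adj a b hf ha hb hab
  by_cases hee : e = e'
  · subst hee; exact key hvX hwX e he hv hw hvw
  · obtain ⟨u, hu, hue, hue', hgu⟩ := hR.inter e he e' he' hee (g v) (hR.mem_edge e he v hv hvX)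
      (hvw ▸ hR.mem_edge e' he' w hw hwX)
    have h1 := key hvX hu e he hv hue hgu
    have h2 := key hwX hu e' he' hw hue' (hvw ▸ hgu)
    exact h1.trans h2.symm

theorem LinearRealization.containsCopy {V : Type*} [Fintype V] [DecidableEq V] {T : SimpleGraph V}
    [DecidableRel T.Adj] {k : ℕ} {H : Finset (Finset ℕ)} {g : V → ℕ} {F : Sym2 V → Finset ℕ}
    (hR : LinearRealization T ∅ H g F) (hH : ∀ E ∈ H, E.card = k) :
    ContainsCopy H (expansion k T) := by
  classical
  set R : Sym2 V → Finset ℕ := fun e => F e \ (univ.filter (fun v => v ∈ e)).image g with hRdef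
  have hsub : ∀ e ∈ T.edgeSet, (univ.filter (fun v => v ∈ e)).image g ⊆ F e := by
    intro e he u hu
    obtain ⟨v, hv, rfl⟩ := mem_image.1 hu
    exact hR.mem_edge e he v (by simpa using hv) (by simp)
  have hRcard : ∀ e ∈ T.edgeSet, (R e).card = k - 2 := by
    intro e he
    rw [hRdef, card_sdiff_of_subset (hsub e he), hH _ (hR.mem_family e he)]
    congr 1
    induction e with
    | h x y =>
      have hxy : T.Adj x y := he
      have : (univ.filter (fun v => v ∈ s(x, y))) = {x, y} := by ext; simp
      rw [this, image_insert, image_singleton,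
        card_pair (hR.ne_of_adj x y hxy (by simp) (by simp))]
  have hex : ∀ e, ∃ h : Fin (k - 2) → ℕ, e ∈ T.edgeSet →
      Function.Injective h ∧ univ.image h = R e := by
    intro e
    by_cases he : e ∈ T.edgeSet
    · exact ⟨(R e).orderEmbOfFin (hRcard e he), fun _ => ⟨((R e).orderEmbOfFin (hRcard e he)).injective,
        image_orderEmbOfFin_univ _ _⟩⟩
    · exact ⟨fun _ => 0, fun h => absurd h he⟩
  choose h hh using hex
  have hRmem : ∀ e ∈ T.edgeSet, ∀ i, h e i ∈ R e := fun e he i => by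
    rw [← (hh e he).2]; exact mem_image_of_mem _ (mem_univ i)
  have hRF : ∀ e ∈ T.edgeSet, ∀ i, h e i ∈ F e := fun e he i => (mem_sdiff.1 (hRmem e he i)).1
  have hRg : ∀ e ∈ T.edgeSet, ∀ i, ∀ v ∈ e, h e i ≠ g v := fun e he i v hv hiv =>
    (mem_sdiff.1 (hRmem e he i)).2 (mem_image.2 ⟨v, by simpa using hv, hiv.symm⟩)
  refine ⟨Sum.elim g (fun p => h p.1 p.2), ?_, ?_⟩
  · have hmem : ∀ p ∈ ((expansion k T).sup id), ∃ e ∈ T.edgeSet,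
        (∃ v ∈ e, p = Sum.inl v) ∨ ∃ i, p = Sum.inr (e, i) := by
      intro p hp
      obtain ⟨E, hE, hpE⟩ := mem_sup.1 hp
      obtain ⟨e, he, rfl⟩ := mem_image.1 hE
      refine ⟨e, by simpa using he, ?_⟩
      rcases mem_union.1 hpE with h1 | h1
      · obtain ⟨v, hv, rfl⟩ := mem_image.1 h1
        exact .inl ⟨v, by simpa using hv, rfl⟩
      · obtain ⟨i, -, rfl⟩ := mem_image.1 h1
        exact .inr ⟨i, rfl⟩
    have hmixed : ∀ e ∈ T.edgeSet, ∀ e' ∈ T.edgeSet, ∀ i, ∀ v ∈ e', h e i ≠ g v := by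
      intro e he e' he' i v hv hiv
      by_cases hee : e = e'
      · subst hee; exact hRg e he i v hv hiv
      · obtain ⟨u, -, hu, -, hiu⟩ := hR.inter e he e' he' hee (h e i) (hRF e he i)
          (hiv ▸ hR.mem_edge e' he' v hv (by simp))
        exact hRg e he i u hu hiu
    intro p hp q hq hpq
    obtain ⟨e, he, hp'⟩ := hmem p hp
    obtain ⟨e', he', hq'⟩ := hmem q hq
    rcases hp' with ⟨v, hv, rfl⟩ | ⟨i, rfl⟩ <;> rcases hq' with ⟨w, hw, rfl⟩ | ⟨j, rfl⟩
    · rw [hR.eq_of_map_eq he he' hv hw (by simp) (by simp) hpq]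
    · exact absurd hpq.symm (hmixed e' he' e he j v hv)
    · exact absurd hpq (hmixed e he e' he' i w hw)
    · have hij : h e i = h e' j := hpq
      by_cases hee : e = e'
      · subst hee; rw [(hh e he).1 hij]
      · obtain ⟨u, -, hu, -, hiu⟩ := hR.inter e he e' he' hee (h e i) (hRF e he i)
          (hij ▸ hRF e' he' j)
        exact absurd hiu (hRg e he i u hu)
  · intro E hE
    obtain ⟨e, he, rfl⟩ := mem_image.1 hE
    have he : e ∈ T.edgeSet := by simpa using he
    have : (((univ.filter (fun v => v ∈ e)).image Sum.inl) ∪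
        (univ.image (fun i : Fin (k - 2) => (Sum.inr (e, i) : V ⊕ Sym2 V × Fin (k - 2))))).image
          (Sum.elim g (fun p => h p.1 p.2)) = F e := by
      rw [image_union, image_image, image_image]
      have h2 : univ.image ((Sum.elim g (fun p => h p.1 p.2)) ∘
          (fun i : Fin (k - 2) => (Sum.inr (e, i) : V ⊕ Sym2 V × Fin (k - 2)))) = R e :=
        (hh e he).2
      rw [h2, Sum.elim_comp_inl, hRdef]
      exact union_sdiff_of_subset (hsub e he)
    rw [this]
    exact hR.mem_family e he

/-- Deleting vertices of small degree: a family with more than `K * |W|` members contains a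
nonempty subfamily in which each marked vertex is marked in more than `K` members. -/
theorem exists_large_degree_subfamily {β : Type*} [DecidableEq β] (m : Finset β → Finset β)
    (K : ℕ) (W : Finset β) : ∀ 𝓗 : Finset (Finset β), (∀ E ∈ 𝓗, m E ⊆ W) →
      K * W.card < 𝓗.card → ∃ 𝓗' ⊆ 𝓗, 𝓗'.Nonempty ∧
        ∀ E ∈ 𝓗', ∀ v ∈ m E, K < (𝓗'.filter (fun E' => v ∈ m E')).card := by
  induction W using Finset.strongInduction with
  | H W ih =>
    intro 𝓗 hW hbig
    by_cases hgood : ∀ E ∈ 𝓗, ∀ v ∈ m E, K < (𝓗.filter (fun E' => v ∈ m E')).card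
    · exact ⟨𝓗, Subset.rfl, card_pos.1 (by omega), hgood⟩
    · push Not at hgood
      obtain ⟨E, hE, v, hv, hdeg⟩ := hgood
      have hvW := hW E hE hv
      have hsum := card_filter_add_card_filter_not (s := 𝓗) (fun E' => v ∈ m E')
      have hWc := card_erase_add_one hvW
      obtain ⟨𝓗', hsub, hne, h'⟩ := ih (W.erase v) (erase_ssubset hvW)
        (𝓗.filter (fun E' => ¬ v ∈ m E'))
        (fun E' hE' u hu => mem_erase.2 ⟨fun huv => (mem_filter.1 hE').2 (huv ▸ hu),
          hW E' (mem_filter.1 hE').1 hu⟩) (by rw [← hWc] at hbig; linarith [mul_add K (W.erase v).card 1])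
      exact ⟨𝓗', hsub.trans (filter_subset _ _), hne, h'⟩

/-- A large family in which pairs of vertices have small codegree contains an extendable family. -/
theorem exists_extendable {β : Type*} [DecidableEq β] (m : Finset β → Finset β) {t P : ℕ}
    {W : Finset β} {𝓗 : Finset (Finset β)} (hm : ∀ E ∈ 𝓗, m E ⊆ E) (hW : ∀ E ∈ 𝓗, E ⊆ W)
    (h2 : ∀ E ∈ 𝓗, 2 ≤ (m E).card)
    (hpair : ∀ v w, v ≠ w → (𝓗.filter (fun E => v ∈ m E ∧ w ∈ E)).card ≤ P)
    (hbig : t * P * W.card < 𝓗.card) : ∃ 𝓗' ⊆ 𝓗, ∃ A, Extendable t A 𝓗' := by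
  obtain ⟨𝓗', hsub, hne, hdeg⟩ := exists_large_degree_subfamily m (t * P) W 𝓗
    (fun E hE => (hm E hE).trans (hW E hE)) hbig
  refine ⟨𝓗', hsub, {v | ∃ E ∈ 𝓗', v ∈ m E}, hne, fun E hE => ?_, ?_⟩
  · obtain ⟨v, hv, w, hw, hvw⟩ := one_lt_card.1 (h2 E (hsub hE))
    exact ⟨v, hm E (hsub hE) hv, w, hm E (hsub hE) hw, hvw, ⟨E, hE, hv⟩, ⟨E, hE, hw⟩⟩
  · rintro v ⟨E₀, hE₀, hv⟩ U hU hvU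
    by_contra! hcon
    have hcover : 𝓗'.filter (fun E' => v ∈ m E') ⊆
        U.biUnion (fun w => 𝓗.filter (fun E => v ∈ m E ∧ w ∈ E)) := by
      intro E hE
      obtain ⟨hE, hvE⟩ := mem_filter.1 hE
      obtain ⟨w, hwE, hwU⟩ := not_disjoint_iff.1 (hcon E hE (hm E (hsub hE) hvE))
      exact mem_biUnion.2 ⟨w, hwU, mem_filter.2 ⟨hsub hE, hvE, hwE⟩⟩
    have h1 := (card_le_card hcover).trans (card_biUnion_le_card_mul U _ P fun w hw =>
      hpair v w (fun hvw => hvU (hvw ▸ hw)))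
    have h3 := hdeg E₀ hE₀ v hv
    have h4 := Nat.mul_le_mul_right P hU
    omega

/-- At most `|W| ^ (r - 2)` of the `r`-subsets of `W` contain two given vertices. -/
theorem card_powersetCard_filter_pair_le {β : Type*} [DecidableEq β] (W : Finset β) (r : ℕ)
    {v w : β} (hvw : v ≠ w) :
    ((W.powersetCard r).filter (fun D => v ∈ D ∧ w ∈ D)).card ≤ W.card ^ (r - 2) := by
  calc _ ≤ (W.powersetCard (r - 2)).card := by
        refine card_le_card_of_injOn (fun D => (D.erase v).erase w) ?_ ?_
        · intro D hD
          obtain ⟨hD, hv, hw⟩ := mem_filter.1 hD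
          obtain ⟨hDW, hDc⟩ := mem_powersetCard.1 hD
          refine mem_powersetCard.2 ⟨(erase_subset _ _).trans ((erase_subset _ _).trans hDW), ?_⟩
          rw [card_erase_of_mem (mem_erase.2 ⟨hvw.symm, hw⟩), card_erase_of_mem hv, hDc]
          omega
        · intro D hD D' hD' hDD'
          obtain ⟨-, hv, hw⟩ := mem_filter.1 hD
          obtain ⟨-, hv', hw'⟩ := mem_filter.1 hD'
          have hDD' : (D.erase v).erase w = (D'.erase v).erase w := hDD'
          rw [← insert_erase hv, ← insert_erase (mem_erase.2 ⟨hvw.symm, hw⟩), hDD',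
            insert_erase (mem_erase.2 ⟨hvw.symm, hw'⟩), insert_erase hv']
    _ ≤ W.card ^ (r - 2) := by rw [card_powersetCard]; exact Nat.choose_le_pow _ _

/-- A uniform family with more than `t * n ^ (r - 2) * n` members contains an extendable family. -/
theorem exists_extendable_of_uniform {β : Type*} [DecidableEq β] {t r : ℕ} {W : Finset β}
    {𝓗 : Finset (Finset β)} (hr : 2 ≤ r) (hW : 𝓗 ⊆ W.powersetCard r)
    (hbig : t * W.card ^ (r - 2) * W.card < 𝓗.card) : ∃ 𝓗' ⊆ 𝓗, ∃ A, Extendable t A 𝓗' :=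
  exists_extendable id (fun _ _ => Subset.rfl) (fun _ hE => (mem_powersetCard.1 (hW hE)).1)
    (fun _ hE => hr.trans_eq (mem_powersetCard.1 (hW hE)).2.symm)
    (fun _ _ hvw => (card_le_card (filter_subset_filter _ hW)).trans
      (card_powersetCard_filter_pair_le W r hvw)) hbig

theorem Extendable.containsCopy {V : Type*} [Fintype V] [DecidableEq V] {T : SimpleGraph V}
    [DecidableRel T.Adj] {k t : ℕ} {A : Set ℕ} {H H' : Finset (Finset ℕ)}
    (h : Extendable t A H') (hsub : H' ⊆ H) (hH : ∀ E ∈ H, E.card = k) (hT : T.IsAcyclic)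
    (ht : k * T.edgeSet.ncard ≤ t) : ContainsCopy H (expansion k T) := by
  obtain ⟨g, F, hR⟩ := h.exists_realization ∅ (fun E hE => (hH E (hsub hE)).le) hT ht
  have hR' : LinearRealization T ∅ H g F := { hR with mem_family := fun e he => hsub (hR.1 e he) }
  exact hR'.containsCopy hH

/-- The number of members of `H` containing `D`. -/
def codegree {β : Type*} [DecidableEq β] (H : Finset (Finset β)) (D : Finset β) : ℕ :=
  (H.filter (fun E => D ⊆ E)).card

/-- An extendable family of sets of large codegree in `H` yields an extendable subfamily of `H`. -/
theorem Extendable.of_codegree {β : Type*} [DecidableEq β] {t r : ℕ} {A : Set β}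
    {G H : Finset (Finset β)} (h : Extendable t A G) (hG : ∀ D ∈ G, D.card = r)
    (hH : ∀ E ∈ H, E.card = r + 1) (hcod : ∀ D ∈ G, t < codegree H D) :
    Extendable t A (H.filter (fun E => ∃ D ∈ G, D ⊆ E)) := by
  have key : ∀ D ∈ G, ∀ U : Finset β, U.card ≤ t → Disjoint D U →
      ∃ E ∈ H, D ⊆ E ∧ Disjoint E U := by
    intro D hD U hU hDU
    by_contra! hcon
    have hsub : H.filter (fun E => D ⊆ E) ⊆ U.image (fun z => insert z D) := by
      intro E hE
      obtain ⟨hE, hDE⟩ := mem_filter.1 hE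
      obtain ⟨z, hzE, hzU⟩ := not_disjoint_iff.1 (hcon E hE hDE)
      have hzD : z ∉ D := fun hzD => disjoint_left.1 hDU hzD hzU
      refine mem_image.2 ⟨z, hzU, eq_of_subset_of_card_le (insert_subset hzE hDE) ?_⟩
      rw [card_insert_of_notMem hzD, hG D hD, hH E hE]
    have := (card_le_card hsub).trans card_image_le
    have := hcod D hD
    unfold codegree at this
    omega
  refine ⟨?_, fun E hE => ?_, fun v hv U hU hvU => ?_⟩
  · obtain ⟨D, hD⟩ := h.nonempty
    obtain ⟨E, hE, hDE, -⟩ := key D hD ∅ (by simp) (by simp)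
    exact ⟨E, mem_filter.2 ⟨hE, D, hD, hDE⟩⟩
  · obtain ⟨-, D, hD, hDE⟩ := mem_filter.1 hE
    obtain ⟨v, hv, w, hw, hvw⟩ := h.two_mem D hD
    exact ⟨v, hDE hv, w, hDE hw, hvw⟩
  · obtain ⟨D, hD, hvD, hDU⟩ := h.extend v hv U hU hvU
    obtain ⟨E, hE, hDE, hEU⟩ := key D hD U hU hDU
    exact ⟨E, mem_filter.2 ⟨hE, D, hD, hDE⟩, hDE hvD, hEU⟩

section ExpansionFree

variable {V : Type*} [Fintype V] [DecidableEq V] {T : SimpleGraph V} [DecidableRel T.Adj]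
  {k t : ℕ} {W : Finset ℕ} {H : Finset (Finset ℕ)}

/-- Few `(k - 1)`-sets have large codegree in an expansion-free family. -/
theorem card_large_codegree_le (hT : T.IsAcyclic) (hk : 3 ≤ k) (hH : H ⊆ W.powersetCard k)
    (hfree : ¬ ContainsCopy H (expansion k T)) (ht : k * T.edgeSet.ncard ≤ t) :
    ((W.powersetCard (k - 1)).filter (fun D => t < codegree H D)).card ≤
      t * W.card ^ (k - 3) * W.card := by
  by_contra! hcon
  obtain ⟨G, hG, A, hA⟩ := exists_extendable_of_uniform (r := k - 1) (by omega)
    (filter_subset _ _) (by rwa [show k - 1 - 2 = k - 3 by omega])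
  have hHk : ∀ E ∈ H, E.card = k := fun E hE => (mem_powersetCard.1 (hH hE)).2
  refine hfree ((hA.of_codegree (r := k - 1) (H := H) (fun D hD => ?_) (fun E hE => ?_)
    (fun D hD => ?_)).containsCopy (filter_subset _ _) hHk hT ht)
  · exact (mem_powersetCard.1 (mem_filter.1 (hG hD)).1).2
  · rw [hHk E hE]; omega
  · exact (mem_filter.1 (hG hD)).2

/-- Few members of an expansion-free family have two `(k - 1)`-subsets of small codegree. -/
theorem card_two_small_codegree_le (hT : T.IsAcyclic) (hk : 4 ≤ k) (hH : H ⊆ W.powersetCard k)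
    (hfree : ¬ ContainsCopy H (expansion k T)) (ht : k * T.edgeSet.ncard ≤ t) :
    (H.filter (fun E => ∃ x ∈ E, ∃ y ∈ E, x ≠ y ∧ codegree H (E.erase x) ≤ t ∧
      codegree H (E.erase y) ≤ t)).card ≤ t * (W.card ^ (k - 3) * t) * W.card := by
  by_contra! hcon
  set B := H.filter (fun E => ∃ x ∈ E, ∃ y ∈ E, x ≠ y ∧ codegree H (E.erase x) ≤ t ∧
      codegree H (E.erase y) ≤ t) with hB
  have hBH : B ⊆ H := filter_subset _ _
  have hHk : ∀ E ∈ H, E.card = k := fun E hE => (mem_powersetCard.1 (hH hE)).2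
  have hxy : ∀ E, ∃ x y, E ∈ B → x ∈ E ∧ y ∈ E ∧ x ≠ y ∧ codegree H (E.erase x) ≤ t ∧
      codegree H (E.erase y) ≤ t := by
    intro E
    by_cases hE : E ∈ B
    · obtain ⟨x, hx, y, hy, h⟩ := (mem_filter.1 hE).2
      exact ⟨x, y, fun _ => ⟨hx, hy, h⟩⟩
    · exact ⟨0, 0, fun h => absurd h hE⟩
  choose x y hxy using hxy
  suffices hext : ∃ H' ⊆ B, ∃ A, Extendable t A H' by
    obtain ⟨H', hH', A, hA⟩ := hext
    exact hfree (hA.containsCopy (hH'.trans hBH) hHk hT ht)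
  refine exists_extendable (W := W) (P := W.card ^ (k - 3) * t)
    (fun E => (E.erase (x E)).erase (y E))
    (fun E _ => (erase_subset _ _).trans (erase_subset _ _))
    (fun E hE => (mem_powersetCard.1 (hH (hBH hE))).1) (fun E hE => ?_) (fun v w hvw => ?_) hcon
  · obtain ⟨hx, hy, hne, -⟩ := hxy E hE
    rw [card_erase_of_mem (mem_erase.2 ⟨hne.symm, hy⟩), card_erase_of_mem hx, hHk E (hBH hE)]
    omega
  · have hcover : B.filter (fun E => v ∈ (E.erase (x E)).erase (y E) ∧ w ∈ E) ⊆
        ((((W.powersetCard (k - 1)).filter (fun D => v ∈ D ∧ w ∈ D)).filter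
          (fun D => codegree H D ≤ t)).biUnion (fun D => H.filter (fun E => D ⊆ E))) := by
      intro E hE
      obtain ⟨hEB, hv, hw⟩ := mem_filter.1 hE
      obtain ⟨hx, hy, hne, hcx, hcy⟩ := hxy E hEB
      obtain ⟨hEW, hEk⟩ := mem_powersetCard.1 (hH (hBH hEB))
      simp only [mem_erase] at hv
      have key : ∀ z ∈ E, codegree H (E.erase z) ≤ t → v ≠ z → w ≠ z → E ∈
          ((((W.powersetCard (k - 1)).filter (fun D => v ∈ D ∧ w ∈ D)).filter
          (fun D => codegree H D ≤ t)).biUnion (fun D => H.filter (fun E => D ⊆ E))) := by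
        intro z hz hcz hvz hwz
        refine mem_biUnion.2 ⟨E.erase z, mem_filter.2 ⟨mem_filter.2 ⟨mem_powersetCard.2
          ⟨(erase_subset _ _).trans hEW, by rw [card_erase_of_mem hz, hEk]⟩,
          mem_erase.2 ⟨hvz, hv.2.2⟩, mem_erase.2 ⟨hwz, hw⟩⟩, hcz⟩,
          mem_filter.2 ⟨hBH hEB, erase_subset _ _⟩⟩
      by_cases hwx : w = x E
      · exact key _ hy hcy hv.1 (hwx ▸ hne)
      · exact key _ hx hcx hv.2.1 hwx
    refine (card_le_card hcover).trans ((card_biUnion_le_card_mul _ _ t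
      fun D hD => (mem_filter.1 hD).2).trans (Nat.mul_le_mul_right t ?_))
    refine (card_le_card (filter_subset _ _)).trans ?_
    have := card_powersetCard_filter_pair_le W (k - 1) hvw
    rwa [show k - 1 - 2 = k - 3 by omega] at this

/-- The minimum defining `σ(T)` is attained. -/
theorem exists_eq_graphSigma {V : Type*} {T : SimpleGraph V} :
    ∃ X : Set V, (∀ x ∈ X, ∀ y ∈ X, ¬ T.Adj x y) ∧ X.Finite ∧
    graphSigma T = X.ncard + {e ∈ T.edgeSet | ∀ x ∈ X, x ∉ e}.ncard :=
  Nat.sInf_mem (s := {m | ∃ X : Set V, (∀ x ∈ X, ∀ y ∈ X, ¬ T.Adj x y) ∧ X.Finite ∧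
    m = X.ncard + {e ∈ T.edgeSet | ∀ x ∈ X, x ∉ e}.ncard})
    ⟨_, ∅, by simp, Set.finite_empty, rfl⟩

/-- Few `(k - 1)`-sets are completed to members of an expansion-free family by each of `σ(T)` given
vertices. -/
theorem card_common_link_le (hT : T.IsAcyclic) (hk : 3 ≤ k) (hH : H ⊆ W.powersetCard k)
    (hfree : ¬ ContainsCopy H (expansion k T)) (ht : k * T.edgeSet.ncard ≤ t) {S : Finset ℕ}
    (hS : graphSigma T ≤ S.card) :
    ((W.powersetCard (k - 1)).filter (fun D => ∀ s ∈ S, s ∉ D ∧ insert s D ∈ H)).card ≤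
      t * W.card ^ (k - 3) * W.card := by
  classical
  by_contra! hcon
  obtain ⟨𝓓, h𝓓, A, hA⟩ := exists_extendable_of_uniform (r := k - 1) (by omega)
    (filter_subset _ _) (by rwa [show k - 1 - 2 = k - 3 by omega])
  have hHk : ∀ E ∈ H, E.card = k := fun E hE => (mem_powersetCard.1 (hH hE)).2
  obtain ⟨X, hX, -, hσ⟩ := exists_eq_graphSigma (T := T)
  have hcard : ∀ D ∈ 𝓓, D.card ≤ k := fun D hD => by
    have := (mem_powersetCard.1 (mem_filter.1 (h𝓓 hD)).1).2
    omega
  obtain ⟨g, F, hR⟩ := hA.exists_realization X hcard hT ht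
  have hF : ∀ e ∈ T.edgeSet, ∀ s ∈ S, s ∉ F e ∧ insert s (F e) ∈ H := fun e he =>
    (mem_filter.1 (h𝓓 (hR.mem_family e he))).2
  /- Assign distinct vertices of `S` to the vertices in `X` and the edges avoiding `X`. -/
  set I : Set (V ⊕ Sym2 V) :=
    Sum.inl '' X ∪ Sum.inr '' {e ∈ T.edgeSet | ∀ x ∈ X, x ∉ e} with hI
  have hIcard : I.ncard ≤ S.card := by
    refine (Set.ncard_union_le _ _).trans ?_
    rwa [Set.ncard_image_of_injective _ Sum.inl_injective,
      Set.ncard_image_of_injective _ Sum.inr_injective, ← hσ]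
  obtain ⟨ψ, hψS, hψinj⟩ : ∃ ψ : V ⊕ Sym2 V → ℕ, (∀ p ∈ I, ψ p ∈ S) ∧ Set.InjOn ψ I := by
    obtain ⟨f⟩ : Nonempty (I ↪ S) := by
      refine Function.Embedding.nonempty_of_card_le ?_
      rwa [Fintype.card_coe, ← Nat.card_eq_fintype_card, Nat.card_coe_set_eq]
    refine ⟨fun p => if h : p ∈ I then f ⟨p, h⟩ else 0, fun p hp => by simp [hp], ?_⟩
    intro p hp q hq hpq
    simpa [hp, hq] using hpq
  have hlabel : ∀ e, ∃ p : V ⊕ Sym2 V, e ∈ T.edgeSet → p ∈ I ∧ (∀ x ∈ X, x ∈ e → p = .inl x) ∧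
      (∀ x, p = .inl x → x ∈ X ∧ x ∈ e) ∧ ∀ e', p = .inr e' → e' = e := by
    intro e
    by_cases hex : ∃ x ∈ X, x ∈ e
    · obtain ⟨x, hx, hxe⟩ := hex
      refine ⟨.inl x, fun he => ⟨.inl ⟨x, hx, rfl⟩, fun y hy hye => ?_, fun y hy => ?_, by simp⟩⟩
      swap
      · exact Sum.inl_injective hy ▸ ⟨hx, hxe⟩
      by_contra hne
      have hxy : x ≠ y := fun h => hne (h ▸ rfl)
      have : e = s(x, y) := (Sym2.mem_and_mem_iff hxy).1 ⟨hxe, hye⟩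
      subst this
      exact hX x hx y hy he
    · push Not at hex
      exact ⟨.inr e, fun he => ⟨.inr ⟨e, ⟨he, hex⟩, rfl⟩, fun x hx hxe => absurd hxe (hex x hx),
        by simp, fun e' h => (Sum.inr_injective h).symm⟩⟩
  choose p hp using hlabel
  have hψp : ∀ e ∈ T.edgeSet, ψ (p e) ∈ S := fun e he => hψS _ (hp e he).1
  refine hfree (LinearRealization.containsCopy (g := fun v => if v ∈ X then ψ (.inl v) else g v)
    (F := fun e => insert (ψ (p e)) (F e)) ⟨?_, ?_, ?_, ?_⟩ hHk)
  · exact fun e he => (hF e he _ (hψp e he)).2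
  · intro e he v hv _
    by_cases hvX : v ∈ X
    · simp [hvX, (hp e he).2.1 v hvX hv]
    · simp [hvX, hR.mem_edge e he v hv hvX]
  · intro x y hxy _ _
    have he : s(x, y) ∈ T.edgeSet := hxy
    by_cases hx : x ∈ X <;> by_cases hy : y ∈ X
    · exact absurd hxy (hX x hx y hy)
    · simp only [hx, hy, if_true, if_false]
      intro h
      have := hR.mem_edge _ he y (by simp) hy
      rw [← h] at this
      exact (hF _ he _ (hψS _ (.inl ⟨x, hx, rfl⟩))).1 this
    · simp only [hx, hy, if_true, if_false]
      intro h
      have := hR.mem_edge _ he x (by simp) hx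
      rw [h] at this
      exact (hF _ he _ (hψS _ (.inl ⟨y, hy, rfl⟩))).1 this
    · simpa only [hx, hy, if_false] using hR.ne_of_adj x y hxy hx hy
  · intro e he e' he' hee u hu hu'
    have hcross : ∀ f ∈ T.edgeSet, ∀ f' ∈ T.edgeSet, ψ (p f) ∉ F f' := fun f hf f' hf' =>
      (hF f' hf' _ (hψp f hf)).1
    rcases mem_insert.1 hu with rfl | hu <;> rcases mem_insert.1 hu' with hu' | hu'
    · have hpp := hψinj (hp e he).1 (hp e' he').1 hu'
      rcases hx : p e with x | e''
      · obtain ⟨hxX, hxe⟩ := (hp e he).2.2.1 x hx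
        exact ⟨x, by simp, hxe, ((hp e' he').2.2.1 x (hpp ▸ hx)).2, by simp [hxX]⟩
      · exact absurd (((hp e he).2.2.2 e'' hx).symm.trans ((hp e' he').2.2.2 e'' (hpp ▸ hx))) hee
    · exact absurd hu' (hcross e he e' he')
    · exact absurd hu (hu' ▸ hcross e' he' e he)
    · obtain ⟨v, hvX, hv, hv', rfl⟩ := hR.inter e he e' he' hee u hu hu'
      exact ⟨v, by simp, hv, hv', by simp [hvX]⟩

end ExpansionFree

open scoped FinsetFamily in
/-- A consequence of the Kruskal–Katona theorem: a family of `(p + 1)`-sets with small shadow `∂𝒜`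
has at most `q * #(∂𝒜)` members, where `q` is such that `#(∂𝒜) < q.choose p`. -/
theorem card_le_card_shadow_mul {N p q : ℕ} {𝒜 : Finset (Finset (Fin N))}
    (h𝒜 : (𝒜 : Set (Finset (Fin N))).Sized (p + 1)) (hq : (∂ 𝒜).card < q.choose p) :
    𝒜.card ≤ (∂ 𝒜).card * q := by
  rcases 𝒜.eq_empty_or_nonempty with rfl | ⟨A, hA⟩
  · simp
  have hpN : p + 1 ≤ N := by
    rw [← h𝒜 hA]; simpa using card_le_univ A
  set x := Nat.findGreatest (fun x => x.choose (p + 1) ≤ 𝒜.card) N with hx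
  have h1 : (p + 1).choose (p + 1) ≤ 𝒜.card := by
    rw [Nat.choose_self]; exact card_pos.2 ⟨A, hA⟩
  have hxp : p + 1 ≤ x := Nat.le_findGreatest hpN h1
  have hxc : x.choose (p + 1) ≤ 𝒜.card :=
    Nat.findGreatest_spec (P := fun x => x.choose (p + 1) ≤ 𝒜.card) hpN h1
  have hxN : x ≤ N := Nat.findGreatest_le N
  have hkk : x.choose p ≤ (∂ 𝒜).card := by
    simpa using kruskal_katona_lovasz_form (i := 1) (by omega) hxp hxN h𝒜 hxc
  have hxq : x + 1 ≤ q := by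
    by_contra! hcon
    exact absurd (Nat.choose_le_choose p (show q ≤ x by omega)) (by omega)
  have hlt : 𝒜.card ≤ (x + 1).choose (p + 1) := by
    rcases hxN.lt_or_eq with hlt | heq
    · exact (not_le.1 (Nat.findGreatest_is_greatest
        (P := fun x => x.choose (p + 1) ≤ 𝒜.card) (Nat.lt_succ_self _) hlt)).le
    · refine h𝒜.card_le.trans ?_
      rw [Fintype.card_fin, ← heq]
      exact Nat.choose_le_choose _ (Nat.le_succ _)
  calc 𝒜.card ≤ (x + 1).choose (p + 1) * (p + 1) := hlt.trans (Nat.le_mul_of_pos_right _ p.succ_pos)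
    _ = x.choose p * (x + 1) := by rw [← Nat.add_one_mul_choose_eq, mul_comm]
    _ ≤ (∂ 𝒜).card * q := Nat.mul_le_mul hkk hxq

theorem card_le_card_mul_of_erase_mem {p q : ℕ} {J G : Finset (Finset ℕ)}
    (hJ : ∀ E ∈ J, E.card = p + 1) (hG : ∀ E ∈ J, ∀ a ∈ E, E.erase a ∈ G)
    (hq : G.card < q.choose p) : J.card ≤ G.card * q := by
  obtain ⟨N, hN⟩ : ∃ N, ∀ E ∈ J, ∀ a ∈ E, a < N := by
    refine ⟨(J.sup id).sup id + 1, fun E hE a ha => Nat.lt_succ_of_le ?_⟩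
    exact le_sup (f := id) (mem_sup.2 ⟨E, hE, ha⟩)
  set 𝒜 : Finset (Finset (Fin N)) := univ.filter (fun A => A.map Fin.valEmbedding ∈ J) with h𝒜
  have hsized : (𝒜 : Set (Finset (Fin N))).Sized (p + 1) := by
    intro A hA
    rw [← card_map Fin.valEmbedding]
    exact hJ _ (mem_filter.1 hA).2
  have hJ𝒜 : J.card ≤ 𝒜.card := by
    refine card_le_card_of_surjOn (fun A => A.map Fin.valEmbedding) ?_
    intro E hE
    have hE' : (univ.filter (fun a : Fin N => (a : ℕ) ∈ E)).map Fin.valEmbedding = E := by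
      ext a
      simp only [mem_map, mem_filter, mem_univ, true_and, Fin.valEmbedding_apply]
      exact ⟨fun ⟨b, hb, hba⟩ => hba ▸ hb, fun ha => ⟨⟨a, hN E hE a ha⟩, ha, rfl⟩⟩
    exact ⟨_, mem_filter.2 ⟨mem_univ _, hE'.symm ▸ hE⟩, hE'⟩
  have hshadow : (shadow 𝒜).card ≤ G.card := by
    refine card_le_card_of_injOn (fun A => A.map Fin.valEmbedding) ?_
      (map_injective _).injOn
    intro A hA
    obtain ⟨B, hB, a, ha, rfl⟩ := mem_shadow_iff.1 hA
    simp only [map_erase]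
    exact hG _ (mem_filter.1 hB).2 _ (mem_map_of_mem _ ha)
  exact hJ𝒜.trans ((card_le_card_shadow_mul hsized (hshadow.trans_lt hq)).trans
    (Nat.mul_le_mul_right q hshadow))

theorem sum_degree_eq {β : Type*} [DecidableEq β] {W : Finset β} {r : ℕ} {G : Finset (Finset β)}
    (hG : G ⊆ W.powersetCard r) : ∑ v ∈ W, (G.filter (fun D => v ∈ D)).card = r * G.card := by
  have h := sum_card_bipartiteAbove_eq_sum_card_bipartiteBelow (s := W) (t := G)
    (fun v D => v ∈ D)
  unfold bipartiteAbove bipartiteBelow at h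
  rw [h, mul_comm, ← smul_eq_mul, ← sum_const]
  refine sum_congr rfl fun D hD => ?_
  obtain ⟨hDW, hDr⟩ := mem_powersetCard.1 (hG hD)
  rw [filter_mem_eq_inter, inter_eq_right.2 hDW, hDr]

theorem card_le_of_not_containsCopy {V : Type*} [Fintype V] [DecidableEq V] {T : SimpleGraph V}
    [DecidableRel T.Adj] {k t q ℓ : ℕ} {W : Finset ℕ} {H : Finset (Finset ℕ)} (hT : T.IsAcyclic)
    (hk : 4 ≤ k) (hH : H ⊆ W.powersetCard k) (hfree : ¬ ContainsCopy H (expansion k T))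
    (ht : k * T.edgeSet.ncard ≤ t)
    (hq : (k - 1) * (t * W.card ^ (k - 2)) < (ℓ + 1) * q.choose (k - 2)) :
    H.card ≤ (graphSigma T - 1) * W.card.choose (k - 1) +
      (t * t + ℓ * 2 ^ ℓ * t) * W.card ^ (k - 2) + (k - 1) * t * W.card ^ (k - 2) * q := by
  classical
  have hpow : W.card ^ (k - 3) * W.card = W.card ^ (k - 2) := by
    rw [← pow_succ]; congr 1; omega
  have hHW : ∀ E ∈ H, E ⊆ W := fun E hE => (mem_powersetCard.1 (hH hE)).1
  have hHk : ∀ E ∈ H, E.card = k := fun E hE => (mem_powersetCard.1 (hH hE)).2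
  set G := (W.powersetCard (k - 1)).filter (fun D => t < codegree H D) with hG
  have hGcard : G.card ≤ t * W.card ^ (k - 2) := by
    rw [← hpow, ← mul_assoc]; exact card_large_codegree_le hT (by omega) hH hfree ht
  set b : Finset ℕ → Prop := fun E => ∃ x ∈ E, ∃ y ∈ E, x ≠ y ∧ codegree H (E.erase x) ≤ t ∧
      codegree H (E.erase y) ≤ t with hb
  have hBcard : (H.filter b).card ≤ t * t * W.card ^ (k - 2) := by
    refine (card_two_small_codegree_le hT hk hH hfree ht).trans_eq ?_
    rw [← hpow]; ring
  set H' := H.filter (fun E => ¬ b E) with hH'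
  have hH'H : H' ⊆ H := filter_subset _ _
  have hcenter : ∀ E, ∃ x, E ∈ H' → x ∈ E ∧ ∀ y ∈ E, y ≠ x → E.erase y ∈ G := by
    intro E
    by_cases hE : E ∈ H'
    swap
    · exact ⟨0, fun h => absurd h hE⟩
    obtain ⟨hEH, hEb⟩ := mem_filter.1 hE
    have hmem : ∀ y ∈ E, t < codegree H (E.erase y) → E.erase y ∈ G := fun y hy hlt =>
      mem_filter.2 ⟨mem_powersetCard.2 ⟨(erase_subset _ _).trans (hHW E hEH),
        by rw [card_erase_of_mem hy, hHk E hEH]⟩, hlt⟩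
    by_cases hx : ∃ x ∈ E, codegree H (E.erase x) ≤ t
    · obtain ⟨x, hxE, hx⟩ := hx
      refine ⟨x, fun _ => ⟨hxE, fun y hy hyx => hmem y hy ?_⟩⟩
      by_contra! hcon
      exact hEb ⟨x, hxE, y, hy, hyx.symm, hx, hcon⟩
    · push Not at hx
      obtain ⟨x, hxE⟩ : E.Nonempty := card_pos.1 (by rw [hHk E hEH]; omega)
      exact ⟨x, fun _ => ⟨hxE, fun y hy _ => hmem y hy (hx y hy)⟩⟩
  choose c hc using hcenter
  set d : ℕ → ℕ := fun v => (G.filter (fun D => v ∈ D)).card with hd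
  have hdsum : ∑ v ∈ W, d v ≤ (k - 1) * (t * W.card ^ (k - 2)) := by
    rw [hd, sum_degree_eq (filter_subset _ _)]
    exact Nat.mul_le_mul_left _ hGcard
  set L := W.filter (fun v => q.choose (k - 2) ≤ d v) with hL
  have hLcard : L.card ≤ ℓ := by
    by_contra! hcon
    have h1 : L.card * q.choose (k - 2) ≤ ∑ v ∈ L, d v := by
      rw [← smul_eq_mul]
      exact card_nsmul_le_sum _ _ _ fun v hv => (mem_filter.1 hv).2
    have h2 : ∑ v ∈ L, d v ≤ ∑ v ∈ W, d v := sum_le_sum_of_subset (filter_subset _ _)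
    have h3 := Nat.mul_le_mul_right (q.choose (k - 2)) (Nat.succ_le_of_lt hcon)
    rw [Nat.succ_eq_add_one] at h3
    omega
  have hsmall : (H'.filter (fun E => ¬ c E ∈ L)).card ≤ (k - 1) * t * W.card ^ (k - 2) * q := by
    have hfib : ∀ v ∈ W.filter (fun v => ¬ v ∈ L),
        ((H'.filter (fun E => ¬ c E ∈ L)).filter (fun E => c E = v)).card ≤ d v * q := by
      intro v hv
      obtain ⟨hvW, hvL⟩ := mem_filter.1 hv
      have hdv : d v < q.choose (k - 2) := by
        by_contra! hcon
        exact hvL (mem_filter.2 ⟨hvW, hcon⟩)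
      set J := (H'.filter (fun E => ¬ c E ∈ L)).filter (fun E => c E = v) with hJ
      have hJmem : ∀ E ∈ J, E ∈ H' ∧ c E = v := fun E hE =>
        ⟨(mem_filter.1 (mem_filter.1 hE).1).1, (mem_filter.1 hE).2⟩
      have hvmem : ∀ E ∈ J, v ∈ E := fun E hE => by
        obtain ⟨h1, rfl⟩ := hJmem E hE
        exact (hc E h1).1
      have hJinj : Set.InjOn (fun E : Finset ℕ => E.erase v) J := by
        intro E hE E' hE' h
        rw [← insert_erase (hvmem E hE), ← insert_erase (hvmem E' hE')]
        exact congrArg (insert v) h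
      rw [← card_image_of_injOn hJinj]
      have hGv : ((G.filter (fun D => v ∈ D)).image (fun D => D.erase v)).card ≤ d v :=
        card_image_le
      refine (card_le_card_mul_of_erase_mem (p := k - 2) ?_ ?_ (hGv.trans_lt hdv)).trans
        (Nat.mul_le_mul_right q hGv)
      · intro D hD
        obtain ⟨E, hE, rfl⟩ := mem_image.1 hD
        rw [card_erase_of_mem (hvmem E hE), hHk E (hH'H (hJmem E hE).1)]
        omega
      · intro D hD a ha
        obtain ⟨E, hE, rfl⟩ := mem_image.1 hD
        obtain ⟨hav, haE⟩ := mem_erase.1 ha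
        obtain ⟨hEH', hcE⟩ := hJmem E hE
        refine mem_image.2 ⟨E.erase a, mem_filter.2 ⟨(hc E hEH').2 a haE (hcE ▸ hav), ?_⟩,
          erase_right_comm⟩
        exact mem_erase.2 ⟨hav.symm, hvmem E hE⟩
    rw [card_eq_sum_card_fiberwise (f := c) (t := W.filter (fun v => ¬ v ∈ L))]
    · calc _ ≤ ∑ v ∈ W.filter (fun v => ¬ v ∈ L), d v * q := sum_le_sum hfib
        _ ≤ ∑ v ∈ W, d v * q := sum_le_sum_of_subset (filter_subset _ _)
        _ = (∑ v ∈ W, d v) * q := (sum_mul _ _ _).symm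
        _ ≤ _ := by rw [mul_assoc (k - 1)]; exact Nat.mul_le_mul_right q hdsum
    · intro E hE
      obtain ⟨h1, h2⟩ := mem_filter.1 hE
      exact mem_filter.2 ⟨hHW E (hH'H h1) (hc E h1).1, h2⟩
  have hlarge : (H'.filter (fun E => c E ∈ L)).card ≤
      (graphSigma T - 1) * W.card.choose (k - 1) + ℓ * 2 ^ ℓ * t * W.card ^ (k - 2) := by
    set S : Finset ℕ → Finset ℕ := fun D => L.filter (fun s => s ∉ D ∧ insert s D ∈ H) with hS
    set bad := (W.powersetCard (k - 1)).filter (fun D => graphSigma T ≤ (S D).card) with hbad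
    have hbadcard : bad.card ≤ 2 ^ ℓ * (t * W.card ^ (k - 2)) := by
      have hcover : bad ⊆ (L.powerset.filter (fun S => graphSigma T ≤ S.card)).biUnion
          (fun S => (W.powersetCard (k - 1)).filter
            (fun D => ∀ s ∈ S, s ∉ D ∧ insert s D ∈ H)) := by
        intro D hD
        obtain ⟨hD, hσ⟩ := mem_filter.1 hD
        exact mem_biUnion.2 ⟨S D, mem_filter.2 ⟨mem_powerset.2 (filter_subset _ _), hσ⟩,
          mem_filter.2 ⟨hD, fun s hs => (mem_filter.1 hs).2⟩⟩
      refine (card_le_card hcover).trans ((card_biUnion_le_card_mul _ _ (t * W.card ^ (k - 2))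
        fun S hS => ?_).trans (Nat.mul_le_mul_right _ ?_))
      · rw [← hpow, ← mul_assoc]
        exact card_common_link_le hT (by omega) hH hfree ht (mem_filter.1 hS).2
      · refine (card_le_card (filter_subset _ _)).trans ?_
        rw [card_powerset]
        exact Nat.pow_le_pow_right (by norm_num) hLcard
    have hfib : ∀ D ∈ W.powersetCard (k - 1),
        ((H'.filter (fun E => c E ∈ L)).filter (fun E => E.erase (c E) = D)).card ≤
          (graphSigma T - 1) + if graphSigma T ≤ (S D).card then ℓ else 0 := by
      intro D _
      have h1 : ((H'.filter (fun E => c E ∈ L)).filter (fun E => E.erase (c E) = D)).card ≤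
          (S D).card := by
        refine card_le_card_of_injOn c ?_ ?_
        · intro E hE
          obtain ⟨hEL, rfl⟩ := mem_filter.1 hE
          obtain ⟨hEH', hcL⟩ := mem_filter.1 hEL
          refine mem_filter.2 ⟨hcL, by simp, ?_⟩
          rw [insert_erase (hc E hEH').1]
          exact hH'H hEH'
        · intro E hE E' hE' hcc
          obtain ⟨hE, hED⟩ := mem_filter.1 hE
          obtain ⟨hE', hED'⟩ := mem_filter.1 hE'
          rw [← insert_erase (hc E (mem_filter.1 hE).1).1,
            ← insert_erase (hc E' (mem_filter.1 hE').1).1, hED, hED', hcc]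
      have h2 : (S D).card ≤ ℓ := (card_le_card (filter_subset _ _)).trans hLcard
      split_ifs <;> omega
    rw [card_eq_sum_card_fiberwise (f := fun E => E.erase (c E)) (t := W.powersetCard (k - 1))]
    · refine (sum_le_sum hfib).trans ?_
      rw [sum_add_distrib, sum_const, card_powersetCard, ← sum_filter, sum_const, smul_eq_mul,
        smul_eq_mul, mul_comm (W.card.choose _)]
      refine Nat.add_le_add_left ((Nat.mul_le_mul_right ℓ hbadcard).trans_eq (by ring)) _
    · intro E hE
      have hE := (mem_filter.1 hE).1
      exact mem_powersetCard.2 ⟨(erase_subset _ _).trans (hHW E (hH'H hE)),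
        by rw [card_erase_of_mem (hc E hE).1, hHk E (hH'H hE)]⟩
  have hsum₁ : (H.filter b).card + H'.card = H.card := by
    rw [hH']; convert card_filter_add_card_filter_not (s := H) b
  have hsum₂ := card_filter_add_card_filter_not (s := H') (fun E => c E ∈ L)
  have hexp : (t * t + ℓ * 2 ^ ℓ * t) * W.card ^ (k - 2) =
    t * t * W.card ^ (k - 2) + ℓ * 2 ^ ℓ * t * W.card ^ (k - 2) := by ring
  omega

theorem one_le_graphSigma {V : Type*} [Finite V] {T : SimpleGraph V} (hne : T.edgeSet.Nonempty) :
    1 ≤ graphSigma T := by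
  obtain ⟨X, -, hXfin, hσ⟩ := exists_eq_graphSigma (T := T)
  rw [hσ, Nat.one_le_iff_ne_zero]
  intro h
  obtain ⟨hX, hE⟩ := Nat.add_eq_zero_iff.1 h
  obtain rfl := (Set.ncard_eq_zero hXfin).1 hX
  rw [Set.ncard_eq_zero (Set.toFinite _)] at hE
  obtain ⟨e, he⟩ := hne
  have : e ∈ {e ∈ T.edgeSet | ∀ x ∈ (∅ : Set V), x ∉ e} := ⟨he, by simp⟩
  rw [hE] at this
  exact this

/-- A family whose members all meet `S` in exactly one vertex contains no copy of `T^(k)`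
if `|S| < σ(T)`. -/
theorem not_containsCopy_of_card_inter_eq_one {V : Type*} [Fintype V] [DecidableEq V]
    {T : SimpleGraph V} [DecidableRel T.Adj] {k : ℕ} {H : Finset (Finset ℕ)} {S : Finset ℕ}
    (hS : S.card < graphSigma T) (hH : ∀ E ∈ H, (E ∩ S).card = 1) :
    ¬ ContainsCopy H (expansion k T) := by
  classical
  rintro ⟨f, hinj, hcopy⟩
  set E : Sym2 V → Finset (V ⊕ Sym2 V × Fin (k - 2)) := fun e =>
    ((univ.filter (fun v => v ∈ e)).image Sum.inl) ∪
      (univ.image (fun i : Fin (k - 2) => Sum.inr (e, i))) with hE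
  have hEmem : ∀ e ∈ T.edgeSet, E e ∈ expansion k T := fun e he =>
    mem_image_of_mem _ (by simpa using he)
  have hEsup : ∀ e ∈ T.edgeSet, ∀ p ∈ E e, p ∈ ((expansion k T).sup id : Finset _) :=
    fun e he p hp => mem_sup.2 ⟨E e, hEmem e he, hp⟩
  have hinl : ∀ e v, (Sum.inl v ∈ E e) ↔ v ∈ e := by intro e v; simp [hE]
  have hinr : ∀ e e' i, (Sum.inr (e', i) ∈ E e) → e' = e := by
    intro e e' i h
    simp only [hE, mem_union, mem_image, reduceCtorEq, and_false, exists_false, false_or,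
      Sum.inr.injEq, Prod.mk.injEq] at h
    obtain ⟨j, -, h, -⟩ := h
    exact h.symm
  have hone : ∀ e ∈ T.edgeSet, ∃ p ∈ E e, f p ∈ S := by
    intro e he
    obtain ⟨u, hu⟩ := card_pos.1 ((hH _ (hcopy _ (hEmem e he))).symm ▸ Nat.one_pos)
    obtain ⟨hu, huS⟩ := mem_inter.1 hu
    obtain ⟨p, hp, rfl⟩ := mem_image.1 hu
    exact ⟨p, hp, huS⟩
  have hunique : ∀ e ∈ T.edgeSet, ∀ p ∈ E e, ∀ p' ∈ E e, f p ∈ S → f p' ∈ S → p = p' := by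
    intro e he p hp p' hp' h h'
    refine hinj (hEsup e he p hp) (hEsup e he p' hp') ?_
    exact card_le_one.1 (hH _ (hcopy _ (hEmem e he))).le _
      (mem_inter.2 ⟨mem_image_of_mem f hp, h⟩) _ (mem_inter.2 ⟨mem_image_of_mem f hp', h'⟩)
  set X : Set V := {v | f (.inl v) ∈ S ∧ ∃ e ∈ T.edgeSet, v ∈ e} with hX
  set Y : Set (Sym2 V) := {e ∈ T.edgeSet | ∀ x ∈ X, x ∉ e} with hY
  have hle : graphSigma T ≤ X.ncard + Y.ncard := by
    refine Nat.sInf_le ⟨X, ?_, Set.toFinite _, rfl⟩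
    rintro x ⟨hx, -⟩ y ⟨hy, -⟩ hxy
    refine hxy.ne (Sum.inl_injective (hunique s(x, y) hxy _ ?_ _ ?_ hx hy)) <;> simp [hinl]
  have hYp : ∀ e, ∃ i : V ⊕ Sym2 V × Fin (k - 2), e ∈ Y →
      i ∈ E e ∧ f i ∈ S ∧ ∃ j, i = .inr (e, j) := by
    intro e
    by_cases he : e ∈ Y
    · obtain ⟨p, hp, hpS⟩ := hone e he.1
      refine ⟨p, fun _ => ⟨hp, hpS, ?_⟩⟩
      rcases p with v | ⟨e', j⟩
      · have hv := (hinl e v).1 hp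
        exact absurd hv (he.2 v ⟨hpS, e, he.1, hv⟩)
      · exact ⟨j, by rw [hinr e e' j hp]⟩
    · obtain ⟨a, -⟩ : ∃ a : V, a ∈ e := ⟨_, e.out_fst_mem⟩
      exact ⟨.inl a, fun h => absurd h he⟩
  choose p hp using hYp
  have hXS : (fun v => f (.inl v)) '' X ∪ (fun e => f (p e)) '' Y ⊆ (S : Set ℕ) := by
    rintro _ (⟨v, hv, rfl⟩ | ⟨e, he, rfl⟩)
    · exact hv.1
    · exact (hp e he).2.1
  have hXinj : Set.InjOn (fun v => f (.inl v)) X := by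
    rintro v ⟨-, e, he, hv⟩ w ⟨-, e', he', hw⟩ h
    exact Sum.inl_injective (hinj (hEsup e he _ ((hinl e v).2 hv))
      (hEsup e' he' _ ((hinl e' w).2 hw)) h)
  have hYinj : Set.InjOn (fun e => f (p e)) Y := by
    intro e he e' he' h
    have h := hinj (hEsup e he.1 _ (hp e he).1) (hEsup e' he'.1 _ (hp e' he').1) h
    obtain ⟨j, hj⟩ := (hp e he).2.2
    obtain ⟨j', hj'⟩ := (hp e' he').2.2
    rw [hj, hj'] at h
    exact (Prod.mk.injEq _ _ _ _ ▸ Sum.inr_injective h).1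
  have hdisj : Disjoint ((fun v => f (.inl v)) '' X) ((fun e => f (p e)) '' Y) := by
    rw [Set.disjoint_left]
    rintro _ ⟨v, ⟨-, e, he, hv⟩, rfl⟩ ⟨e', he', h⟩
    have h := hinj (hEsup e' he'.1 _ (hp e' he').1) (hEsup e he _ ((hinl e v).2 hv)) h
    obtain ⟨j, hj⟩ := (hp e' he').2.2
    rw [hj] at h
    cases h
  have := Set.ncard_le_ncard hXS (Set.toFinite _)
  rw [Set.ncard_union_eq hdisj (Set.toFinite _) (Set.toFinite _), hXinj.ncard_image,
    hYinj.ncard_image, Set.ncard_coe_finset] at this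
  omega

theorem card_mul_choose_le_card_filter_inter {W S : Finset ℕ} (hS : S ⊆ W) {k : ℕ} (hk : 1 ≤ k) :
    S.card * (W.card - S.card).choose (k - 1) ≤
      ((W.powersetCard k).filter (fun E => (E ∩ S).card = 1)).card := by
  rw [← card_sdiff_of_subset hS, ← card_powersetCard, ← card_product]
  have hmem : ∀ q ∈ S ×ˢ (W \ S).powersetCard (k - 1), q.1 ∈ S ∧ q.2 ⊆ W ∧ Disjoint q.2 S ∧
      q.2.card = k - 1 := by
    intro q hq
    obtain ⟨h1, h2⟩ := mem_product.1 hq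
    obtain ⟨h2, h3⟩ := mem_powersetCard.1 h2
    exact ⟨h1, h2.trans sdiff_subset, disjoint_of_subset_left h2 sdiff_disjoint, h3⟩
  have hinter : ∀ q ∈ S ×ˢ (W \ S).powersetCard (k - 1), insert q.1 q.2 ∩ S = {q.1} := by
    intro q hq
    obtain ⟨h1, -, h2, -⟩ := hmem q hq
    rw [insert_inter_of_mem h1, disjoint_iff_inter_eq_empty.1 h2]; rfl
  refine card_le_card_of_injOn (fun q => insert q.1 q.2) ?_ ?_
  · intro q hq
    obtain ⟨h1, h2, h3, h4⟩ := hmem q hq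
    refine mem_filter.2 ⟨mem_powersetCard.2 ⟨insert_subset (hS h1) h2, ?_⟩, ?_⟩
    · rw [card_insert_of_notMem (disjoint_right.1 h3 h1), h4]; omega
    · rw [hinter q hq, card_singleton]
  · intro q hq q' hq' h
    have h : insert q.1 q.2 = insert q'.1 q'.2 := h
    have h1 : q.1 = q'.1 := by
      rw [← singleton_inj, ← hinter q hq, ← hinter q' hq', h]
    refine Prod.ext h1 ?_
    rw [← erase_insert (disjoint_right.1 (hmem q hq).2.2.1 (hmem q hq).1), h, h1,
      erase_insert (disjoint_right.1 (hmem q' hq').2.2.1 (hmem q' hq').1)]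

theorem choose_le_choose_sub_add (n a j : ℕ) :
    n.choose (j + 1) ≤ (n - a).choose (j + 1) + a * n ^ j := by
  induction a with
  | zero => simp
  | succ a ih =>
    have h : (n - a).choose (j + 1) ≤ (n - (a + 1)).choose (j + 1) + n ^ j := by
      rcases Nat.lt_or_ge a n with h | h
      · obtain ⟨b, hb⟩ : ∃ b, n - a = b + 1 := ⟨n - a - 1, by omega⟩
        rw [show n - (a + 1) = b by omega, hb, Nat.choose_succ_succ']
        have := (Nat.choose_le_pow b j).trans (Nat.pow_le_pow_left (show b ≤ n by omega) j)
        omega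
      · simp [show n - a = 0 by omega]
    rw [add_mul, one_mul]
    omega

theorem pow_le_factorial_mul_choose (n r : ℕ) :
    (n + 1 - r) ^ r ≤ r.factorial * n.choose r := by
  rw [← Nat.descFactorial_eq_factorial_mul_choose]
  exact Nat.pow_sub_le_descFactorial n r

theorem pow_le_two_pow_mul_choose {n r : ℕ} (h : 2 * r ≤ n) :
    n ^ r ≤ 2 ^ r * r.factorial * n.choose r :=
  calc n ^ r ≤ (2 * (n + 1 - r)) ^ r := Nat.pow_le_pow_left (by omega) r
    _ = 2 ^ r * (n + 1 - r) ^ r := mul_pow _ _ _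
    _ ≤ 2 ^ r * (r.factorial * n.choose r) :=
      Nat.mul_le_mul_left _ (pow_le_factorial_mul_choose n r)
    _ = _ := (mul_assoc _ _ _).symm

/-- Lower-order terms are negligible compared with `n.choose (j + 1)`. -/
theorem eventually_mul_pow_le_mul_choose (j : ℕ) (C : ℝ) {ε : ℝ} (hε : 0 < ε) :
    ∃ N : ℕ, ∀ n ≥ N, C * (n : ℝ) ^ j ≤ ε * n.choose (j + 1) := by
  set c : ℝ := 2 ^ (j + 1) * (j + 1).factorial with hc
  have hcpos : 0 < c := by positivity
  obtain ⟨N, hN⟩ := exists_nat_ge (C * c / ε)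
  refine ⟨max N (2 * (j + 1)), fun n hn => ?_⟩
  have h1 : (n : ℝ) ^ (j + 1) ≤ c * n.choose (j + 1) := by
    rw [hc]; exact_mod_cast pow_le_two_pow_mul_choose ((le_max_right _ _).trans hn)
  have h2 : C * c ≤ ε * n := by
    have : (N : ℝ) ≤ n := by exact_mod_cast (le_max_left _ _).trans hn
    rw [div_le_iff₀ hε] at hN
    nlinarith
  have h3 : C * c * (n : ℝ) ^ j ≤ ε * n * (n : ℝ) ^ j :=
    mul_le_mul_of_nonneg_right h2 (by positivity)
  refine le_of_mul_le_mul_right ?_ hcpos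
  calc C * (n : ℝ) ^ j * c = C * c * (n : ℝ) ^ j := by ring
    _ ≤ ε * n * (n : ℝ) ^ j := h3
    _ = ε * (n : ℝ) ^ (j + 1) := by ring
    _ ≤ ε * (c * n.choose (j + 1)) := mul_le_mul_of_nonneg_left h1 hε.le
    _ = ε * n.choose (j + 1) * c := by ring

theorem upper_bound {V : Type*} [Fintype V] [DecidableEq V] {T : SimpleGraph V}
    [DecidableRel T.Adj] (hT : T.IsAcyclic) (hne : T.edgeSet.Nonempty) {k : ℕ} (hk : 4 ≤ k)
    {ε : ℝ} (hε : 0 < ε) : ∃ N : ℕ, ∀ n ≥ N, ∀ (W : Finset ℕ) (H : Finset (Finset ℕ)),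
      W.card = n → (∀ E ∈ H, E ⊆ W ∧ E.card = k) → ¬ ContainsCopy H (expansion k T) →
        (H.card : ℝ) ≤ ((graphSigma T : ℝ) - 1 + ε) * Nat.choose n (k - 1) := by
  obtain ⟨j, rfl⟩ : ∃ j, k = j + 2 := ⟨k - 2, by omega⟩
  set t := (j + 2) * T.edgeSet.ncard with ht
  set c : ℝ := 2 ^ (j + 1) * (j + 1).factorial with hc
  obtain ⟨M, hM⟩ := exists_nat_ge (max 1 (2 * ((j + 1) * t * c) / ε))
  have hM1 : 1 ≤ M := by exact_mod_cast (le_max_left _ _).trans hM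
  have hMpos : (0 : ℝ) < M := by exact_mod_cast hM1
  have hMε : (j + 1) * t * c ≤ ε / 2 * M := by
    have := (le_max_right _ _).trans hM
    rw [div_le_iff₀ hε] at this
    linarith
  set ℓ := (j + 1) * t * (j.factorial * (2 * M) ^ j) with hℓ
  obtain ⟨N, hN⟩ := eventually_mul_pow_le_mul_choose j ((t * t + ℓ * 2 ^ ℓ * t : ℕ) : ℝ)
    (half_pos hε)
  refine ⟨max N (max (2 * (j + 1)) (2 * M * (j + 1))), fun n hn W H hW hH hfree => ?_⟩
  have hnN : N ≤ n := (le_max_left _ _).trans hn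
  have hnj : 2 * (j + 1) ≤ n := (le_max_left _ _).trans ((le_max_right _ _).trans hn)
  have hnM : 2 * M * (j + 1) ≤ n := (le_max_right _ _).trans ((le_max_right _ _).trans hn)
  have hq : n ^ j ≤ j.factorial * (2 * M) ^ j * (n / M).choose j := by
    have h1 : n ≤ 2 * M * (n / M + 1 - j) := by
      have hdiv := Nat.div_add_mod n M
      have hmod := Nat.mod_lt n (show 0 < M by omega)
      have hjq : j ≤ n / M := by
        rw [Nat.le_div_iff_mul_le (by omega)]; nlinarith
      obtain ⟨a, ha⟩ := Nat.exists_eq_add_of_le hjq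
      rw [ha] at hdiv ⊢
      rw [show j + a + 1 - j = a + 1 by omega]
      nlinarith
    calc n ^ j ≤ (2 * M * (n / M + 1 - j)) ^ j := Nat.pow_le_pow_left h1 j
      _ = (2 * M) ^ j * (n / M + 1 - j) ^ j := mul_pow _ _ _
      _ ≤ (2 * M) ^ j * (j.factorial * (n / M).choose j) :=
        Nat.mul_le_mul_left _ (pow_le_factorial_mul_choose _ _)
      _ = _ := by ring
  have hchoose : 0 < (n / M).choose j := by
    refine Nat.pos_of_ne_zero fun h0 => ?_
    rw [h0, mul_zero] at hq
    have : 0 < n ^ j := pow_pos (by omega) j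
    omega
  have hmain := card_le_of_not_containsCopy (t := t) (q := n / M) (ℓ := ℓ) (W := W) hT hk
    (fun E hE => mem_powersetCard.2 (hH E hE)) hfree le_rfl (by
      rw [hW]
      calc (j + 1) * (t * n ^ j) ≤ (j + 1) * (t * (j.factorial * (2 * M) ^ j * (n / M).choose j)) :=
            Nat.mul_le_mul_left _ (Nat.mul_le_mul_left _ hq)
        _ = ℓ * (n / M).choose j := by rw [hℓ]; ring
        _ < (ℓ + 1) * (n / M).choose j := Nat.mul_lt_mul_of_pos_right (Nat.lt_succ_self _) hchoose)
  rw [hW, show j + 2 - 1 = j + 1 from rfl, show j + 2 - 2 = j from rfl] at hmain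
  have hmain' : (H.card : ℝ) ≤ ((graphSigma T : ℝ) - 1) * n.choose (j + 1) +
      ((t * t + ℓ * 2 ^ ℓ * t : ℕ) : ℝ) * (n : ℝ) ^ j +
      (j + 1) * t * (n : ℝ) ^ j * (n / M : ℕ) := by
    have := (Nat.cast_le (α := ℝ)).2 hmain
    rw [Nat.cast_add, Nat.cast_add, Nat.cast_mul, Nat.cast_mul, Nat.cast_sub (one_le_graphSigma hne)]
      at this
    push_cast at this ⊢
    exact this
  have hlast : (j + 1) * t * (n : ℝ) ^ j * (n / M : ℕ) ≤ ε / 2 * n.choose (j + 1) := by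
    have h1 : (n : ℝ) ^ (j + 1) ≤ c * n.choose (j + 1) := by
      rw [hc]; exact_mod_cast pow_le_two_pow_mul_choose hnj
    calc (j + 1) * t * (n : ℝ) ^ j * (n / M : ℕ) ≤ (j + 1) * t * (n : ℝ) ^ j * (n / M) :=
          mul_le_mul_of_nonneg_left Nat.cast_div_le (by positivity)
      _ = (j + 1) * t * (n : ℝ) ^ (j + 1) / M := by ring
      _ ≤ (j + 1) * t * (c * n.choose (j + 1)) / M := by gcongr
      _ = (j + 1) * t * c / M * n.choose (j + 1) := by ring
      _ ≤ ε / 2 * n.choose (j + 1) :=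
          mul_le_mul_of_nonneg_right ((div_le_iff₀ hMpos).2 hMε) (Nat.cast_nonneg _)
  have := hN n hnN
  rw [show j + 2 - 1 = j + 1 from rfl]
  linarith

theorem lower_bound {V : Type*} [Fintype V] [DecidableEq V] {T : SimpleGraph V}
    [DecidableRel T.Adj] (hne : T.edgeSet.Nonempty) {k : ℕ} (hk : 2 ≤ k)
    {ε : ℝ} (hε : 0 < ε) : ∃ N : ℕ, ∀ n ≥ N, ∃ (W : Finset ℕ) (H : Finset (Finset ℕ)),
      W.card = n ∧ (∀ E ∈ H, E ⊆ W ∧ E.card = k) ∧ ¬ ContainsCopy H (expansion k T) ∧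
        ((graphSigma T : ℝ) - 1 - ε) * Nat.choose n (k - 1) ≤ (H.card : ℝ) := by
  obtain ⟨j, rfl⟩ : ∃ j, k = j + 2 := ⟨k - 2, by omega⟩
  obtain ⟨a, ha⟩ : ∃ a, graphSigma T = a + 1 :=
    ⟨_, (Nat.sub_add_cancel (one_le_graphSigma hne)).symm⟩
  obtain ⟨N, hN⟩ := eventually_mul_pow_le_mul_choose j ((a : ℝ) * a) hε
  refine ⟨max N a, fun n hn => ⟨range n,
    ((range n).powersetCard (j + 2)).filter (fun E => (E ∩ range a).card = 1), card_range n,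
    fun E hE => mem_powersetCard.1 (mem_filter.1 hE).1, ?_, ?_⟩⟩
  · exact not_containsCopy_of_card_inter_eq_one (by rw [card_range, ha]; exact Nat.lt_succ_self a)
      fun E hE => (mem_filter.1 hE).2
  · have h1 := card_mul_choose_le_card_filter_inter (k := j + 2)
      (range_subset_range.2 ((le_max_right N a).trans hn)) (by omega)
    rw [card_range, card_range] at h1
    have h1' := (Nat.cast_le (α := ℝ)).2 h1
    have h2 := (Nat.cast_le (α := ℝ)).2 (choose_le_choose_sub_add n a j)
    have h3 := hN n ((le_max_left _ _).trans hn)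
    have h4 := mul_le_mul_of_nonneg_left h2 (Nat.cast_nonneg (α := ℝ) a)
    rw [show j + 2 - 1 = j + 1 from rfl] at h1' ⊢
    push_cast at h1' h4
    rw [ha]
    push_cast
    linarith

end

/-- Main theorem: for a forest `T` with at least one edge which is not a star and `k ≥ 4`,
`ex_k(n, T^(k)) = (σ(T) - 1 + o(1))·C(n, k-1)` as `n → ∞`. -/
theorem stmt_17 {V : Type*} [Fintype V] [DecidableEq V] (T : SimpleGraph V)
    [DecidableRel T.Adj] (hT : T.IsAcyclic) (hne : T.edgeSet.Nonempty)
    (hstar : ¬ ∃ x : V, ∀ e ∈ T.edgeSet, x ∈ e) (k : ℕ) (hk : 4 ≤ k) :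
    ∀ ε : ℝ, 0 < ε → ∃ N : ℕ, ∀ n ≥ N,
      (∀ (W : Finset ℕ) (H : Finset (Finset ℕ)), W.card = n →
        (∀ E ∈ H, E ⊆ W ∧ E.card = k) → ¬ ContainsCopy H (expansion k T) →
        (H.card : ℝ) ≤ ((graphSigma T : ℝ) - 1 + ε) * Nat.choose n (k - 1)) ∧
      (∃ (W : Finset ℕ) (H : Finset (Finset ℕ)), W.card = n ∧
        (∀ E ∈ H, E ⊆ W ∧ E.card = k) ∧ ¬ ContainsCopy H (expansion k T) ∧
        ((graphSigma T : ℝ) - 1 - ε) * Nat.choose n (k - 1) ≤ (H.card : ℝ)) := by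
  intro ε hε
  obtain ⟨N₁, h₁⟩ := upper_bound hT hne hk hε
  obtain ⟨N₂, h₂⟩ := lower_bound (k := k) hne (by omega) hε
  exact ⟨max N₁ N₂, fun n hn => ⟨h₁ n ((le_max_left _ _).trans hn),
    h₂ n ((le_max_right _ _).trans hn)⟩⟩
end
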